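/- arXiv:1704.00208 — 4 statements merged into one kernel-verified Lean document; each statement's English description precedes it below -/
import Mathlib

section
/- (Proposition 3.1(a)) Let h : ℝ → ℝ be a Schwartz function, σ = ∫_ℝ h √M dv, u = ∫_ℝ h v √M dv, and (1-Π)h = h - σ√M - u v√M. Then -∫_ℝ h (L h) dv = -∫_ℝ ((1-Π)h) (L (1-Π)h) dv + u². -/
open MeasureTheory Real

/-- The one-dimensional global Maxwellian. -/
noncomputable def Maxwellian (v : ℝ) : ℝ := (2 * Real.pi) ^ (-(1:ℝ)/2) * Real.exp (-v^2 / 2)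

/-- The linearized Fokker–Planck operator
`(L f)(v) = M(v)^(-1/2) d/dv ( M(v) d/dv ( f(v) M(v)^(-1/2) ) )`. -/
noncomputable def FPL (f : ℝ → ℝ) : ℝ → ℝ := fun v =>
  (Maxwellian v) ^ (-(1:ℝ)/2) *
    deriv (fun w => Maxwellian w * deriv (fun y => f y * (Maxwellian y) ^ (-(1:ℝ)/2)) w) v

lemma Maxwellian_pos (v : ℝ) : 0 < Maxwellian v := by
  unfold Maxwellian; positivity

lemma Maxwellian_rpow_neg_half (v : ℝ) :
    Maxwellian v ^ (-(1:ℝ)/2) = (√(Maxwellian v))⁻¹ := by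
  rw [neg_div, rpow_neg (Maxwellian_pos v).le, ← sqrt_eq_rpow]

lemma hasDerivAt_Maxwellian (v : ℝ) : HasDerivAt Maxwellian (-v * Maxwellian v) v := by
  have h := ((((hasDerivAt_id v).pow 2).neg.div_const 2).exp).const_mul
    ((2 * Real.pi) ^ (-(1:ℝ)/2))
  refine h.congr_deriv ?_
  simp [Maxwellian]
  ring

lemma hasDerivAt_sqrt_Maxwellian (v : ℝ) :
    HasDerivAt (fun w => √(Maxwellian w)) (-(v / 2) * √(Maxwellian v)) v := by
  have hs : 0 < √(Maxwellian v) := sqrt_pos.2 (Maxwellian_pos v)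
  refine ((hasDerivAt_Maxwellian v).sqrt (Maxwellian_pos v).ne').congr_deriv ?_
  rw [div_eq_iff (by positivity)]
  linear_combination v * (mul_self_sqrt (Maxwellian_pos v).le)

lemma continuous_sqrt_Maxwellian : Continuous fun v => √(Maxwellian v) :=
  continuous_iff_continuousAt.2 fun v => (hasDerivAt_sqrt_Maxwellian v).continuousAt

lemma sqrt_Maxwellian_le (v : ℝ) : √(Maxwellian v) ≤ √((2 * Real.pi) ^ (-(1:ℝ)/2)) := by
  refine sqrt_le_sqrt ?_
  refine mul_le_of_le_one_right (by positivity) ?_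
  rw [exp_le_one_iff]
  nlinarith [sq_nonneg v]

/-- The expanded form of the Fokker–Planck operator on twice differentiable functions. -/
lemma FPL_eq {f f' f'' : ℝ → ℝ} (hf : ∀ v, HasDerivAt f (f' v) v)
    (hf' : ∀ v, HasDerivAt f' (f'' v) v) (v : ℝ) :
    FPL f v = f'' v + (1 / 2 - v ^ 2 / 4) * f v := by
  have hne : ∀ w, √(Maxwellian w) ≠ 0 := fun w => (sqrt_pos.2 (Maxwellian_pos w)).ne'
  have inner_eq : (fun w => Maxwellian w * deriv (fun y => f y * Maxwellian y ^ (-(1:ℝ)/2)) w)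
      = fun w => √(Maxwellian w) * (f' w + w / 2 * f w) := by
    funext w
    simp_rw [Maxwellian_rpow_neg_half]
    have inner : HasDerivAt (fun y => f y * (√(Maxwellian y))⁻¹) _ w :=
      (hf w).mul ((hasDerivAt_sqrt_Maxwellian w).inv (hne w))
    rw [inner.deriv]
    nth_rewrite 1 [← mul_self_sqrt (Maxwellian_pos w).le]
    have := hne w
    field_simp
  have outer : HasDerivAt (fun w => √(Maxwellian w) * (f' w + w / 2 * f w)) _ v :=
    (hasDerivAt_sqrt_Maxwellian v).mul
      ((hf' v).add (((hasDerivAt_id v).div_const 2).mul (hf v)))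
  have : FPL f v = (√(Maxwellian v))⁻¹ * deriv
      (fun w => √(Maxwellian w) * (f' w + w / 2 * f w)) v := by
    rw [FPL, inner_eq, Maxwellian_rpow_neg_half]
  rw [this, outer.deriv]
  have := hne v
  simp
  field_simp
  ring

lemma integrable_pow_mul_sqrt_Maxwellian_mul (f : SchwartzMap ℝ ℝ) (k : ℕ) :
    Integrable fun v => v ^ k * √(Maxwellian v) * f v := by
  have hf : Integrable fun v => v ^ k * f v :=
    (f.integrable_pow_mul volume k).mono
      (((continuous_pow k).mul f.continuous).aestronglyMeasurable) (by simp)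
  refine (hf.bdd_mul (c := √((2 * Real.pi) ^ (-(1:ℝ)/2)))
    continuous_sqrt_Maxwellian.aestronglyMeasurable (.of_forall fun v => ?_)).congr
    (.of_forall fun v => ?_)
  · rw [norm_of_nonneg (sqrt_nonneg _)]
    exact sqrt_Maxwellian_le v
  · simp only
    ring

lemma integrable_pow_mul_mul (f g : SchwartzMap ℝ ℝ) (k : ℕ) :
    Integrable fun v => v ^ k * f v * g v := by
  have hf : Integrable fun v => v ^ k * f v :=
    (f.integrable_pow_mul volume k).mono
      (((continuous_pow k).mul f.continuous).aestronglyMeasurable) (by simp)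
  exact hf.mul_bdd g.continuous.aestronglyMeasurable
    (.of_forall fun v => g.norm_le_seminorm ℝ v)

lemma integrable_pow_mul_Maxwellian (k : ℕ) : Integrable fun v => v ^ k * Maxwellian v := by
  have h := (integrable_rpow_mul_exp_neg_mul_sq (b := 1 / 2) (by norm_num) (s := k)
    (by have := k.cast_nonneg (α := ℝ); linarith)).const_mul ((2 * Real.pi) ^ (-(1:ℝ)/2))
  refine h.congr (.of_forall fun v => ?_)
  simp only [Maxwellian, rpow_natCast]
  rw [show -(1 / 2) * v ^ 2 = -v ^ 2 / 2 by ring]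
  ring

lemma integral_Maxwellian : ∫ v, Maxwellian v = 1 := by
  have h := integral_gaussian (1 / 2)
  have e : Maxwellian = fun v => (2 * Real.pi) ^ (-(1:ℝ)/2) * exp (-(1 / 2) * v ^ 2) := by
    funext v
    rw [Maxwellian, show -(1 / 2) * v ^ 2 = -v ^ 2 / 2 by ring]
  rw [e, integral_const_mul, h, neg_div, rpow_neg (by positivity), ← sqrt_eq_rpow,
    show π / (1 / 2) = 2 * π by ring]
  exact inv_mul_cancel₀ (by positivity)

lemma integral_id_mul_Maxwellian : ∫ v, v * Maxwellian v = 0 := by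
  have h := integral_eq_zero_of_hasDerivAt_of_integrable hasDerivAt_Maxwellian
    (by simpa using (integrable_pow_mul_Maxwellian 1).neg)
    (by simpa using integrable_pow_mul_Maxwellian 0)
  simpa [integral_neg] using h

lemma integral_sq_mul_Maxwellian : ∫ v, v ^ 2 * Maxwellian v = 1 := by
  have i0 : Integrable Maxwellian := by simpa using integrable_pow_mul_Maxwellian 0
  have i2 := integrable_pow_mul_Maxwellian 2
  have h := integral_eq_zero_of_hasDerivAt_of_integrable
    (f := fun v => v * Maxwellian v) (f' := fun v => Maxwellian v - v ^ 2 * Maxwellian v)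
    (fun v => ((hasDerivAt_id v).mul (hasDerivAt_Maxwellian v)).congr_deriv (by simp; ring))
    (i0.sub i2) (by simpa using integrable_pow_mul_Maxwellian 1)
  rw [integral_sub i0 i2, integral_Maxwellian] at h
  linarith

theorem prop_3_1_a (h : SchwartzMap ℝ ℝ) (σ u : ℝ)
    (hσ : σ = ∫ v : ℝ, h v * Real.sqrt (Maxwellian v))
    (hu : u = ∫ v : ℝ, h v * (v * Real.sqrt (Maxwellian v)))
    (g : ℝ → ℝ)
    (hg : g = fun v => h v - σ * Real.sqrt (Maxwellian v) - u * (v * Real.sqrt (Maxwellian v))) :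
    -(∫ v : ℝ, h v * FPL (fun w => h w) v)
      = -(∫ v : ℝ, g v * FPL g v) + u^2 := by
  set h₁ : SchwartzMap ℝ ℝ := SchwartzMap.derivCLM ℝ ℝ h
  set h₂ : SchwartzMap ℝ ℝ := SchwartzMap.derivCLM ℝ ℝ h₁
  have d₁ : ∀ v, HasDerivAt h (h₁ v) v := h.hasDerivAt
  have d₂ : ∀ v, HasDerivAt h₁ (h₂ v) v := h₁.hasDerivAt
  set s : ℝ → ℝ := fun v => √(Maxwellian v)
  have ds : ∀ v, HasDerivAt s (-(v / 2) * s v) v := hasDerivAt_sqrt_Maxwellian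
  have ss : ∀ v, s v * s v = Maxwellian v := fun v => mul_self_sqrt (Maxwellian_pos v).le
  have I : ∀ (k : ℕ) (f : SchwartzMap ℝ ℝ), Integrable fun v => v ^ k * s v * f v :=
    fun k f => integrable_pow_mul_sqrt_Maxwellian_mul f k
  set l : ℝ → ℝ := fun v => h₂ v + (1 / 2 - v ^ 2 / 4) * h v with hl
  have Lh : ∀ v, FPL (fun w => h w) v = l v := FPL_eq d₁ d₂
  have Lg : ∀ v, FPL g v = l v + u * (v * s v) := by
    intro v
    subst hg
    rw [FPL_eq (f' := fun v => h₁ v - σ * (-(v / 2) * s v) - u * ((1 - v ^ 2 / 2) * s v))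
      (f'' := fun v => h₂ v - σ * ((v ^ 2 / 4 - 1 / 2) * s v)
        - u * ((v ^ 3 / 4 - 3 * v / 2) * s v))]
    · simp only [hl]
      ring
    · intro v
      refine (((d₁ v).sub ((ds v).const_mul σ)).sub
        (((hasDerivAt_id v).mul (ds v)).const_mul u)).congr_deriv ?_
      simp only [id]
      ring
    · intro v
      refine (((d₂ v).sub ((((hasDerivAt_id v).div_const 2).neg.mul (ds v)).const_mul σ)).sub
        ((((((hasDerivAt_id v).pow 2).div_const 2).const_sub 1).mul
          (ds v)).const_mul u)).congr_deriv ?_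
      simp
      ring
  have i_hl : Integrable fun v => h v * l v := by
    refine (((integrable_pow_mul_mul h h₂ 0).add ((integrable_pow_mul_mul h h 0).const_mul
      (1 / 2))).sub ((integrable_pow_mul_mul h h 2).const_mul (1 / 4))).congr
      (.of_forall fun v => ?_)
    simp [hl]
    ring
  have i_sl : Integrable fun v => s v * l v := by
    refine (((I 0 h₂).add ((I 0 h).const_mul (1 / 2))).sub ((I 2 h).const_mul (1 / 4))).congr
      (.of_forall fun v => ?_)
    simp [hl]
    ring
  have i_vsl : Integrable fun v => v * s v * l v := by
    refine (((I 1 h₂).add ((I 1 h).const_mul (1 / 2))).sub ((I 3 h).const_mul (1 / 4))).congr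
      (.of_forall fun v => ?_)
    simp [hl]
    ring
  have i_hvs : Integrable fun v => h v * (v * s v) :=
    (I 1 h).congr (.of_forall fun v => by simp; ring)
  have i_vM : Integrable fun v => v * Maxwellian v := by
    simpa using integrable_pow_mul_Maxwellian 1
  have i_v2M := integrable_pow_mul_Maxwellian 2
  have int_sl : ∫ v, s v * l v = 0 := by
    refine integral_eq_zero_of_hasDerivAt_of_integrable
      (f := fun v => s v * (h₁ v + v / 2 * h v)) (fun v => ?_) i_sl
      (((I 0 h₁).add ((I 1 h).const_mul (1 / 2))).congr (.of_forall fun v => ?_))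
    · refine ((ds v).mul ((d₂ v).add
        (((hasDerivAt_id v).div_const 2).mul (d₁ v)))).congr_deriv ?_
      simp [hl]
      ring
    · simp
      ring
  have int_vsl : ∫ v, v * s v * l v = -u := by
    have key : ∫ v, (v * s v * l v + h v * (v * s v)) = 0 := by
      refine integral_eq_zero_of_hasDerivAt_of_integrable
        (f := fun v => s v * (v * h₁ v - (1 - v ^ 2 / 2) * h v)) (fun v => ?_) (i_vsl.add i_hvs)
        ((((I 1 h₁).sub (I 0 h)).add ((I 2 h).const_mul (1 / 2))).congr (.of_forall fun v => ?_))
      · refine ((ds v).mul (((hasDerivAt_id v).mul (d₂ v)).sub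
          (((((hasDerivAt_id v).pow 2).div_const 2).const_sub 1).mul (d₁ v)))).congr_deriv ?_
        simp [hl]
        ring
      · simp
        ring
    rw [integral_add i_vsl i_hvs, ← hu] at key
    linarith
  have expand : ∀ v, g v * FPL g v = h v * l v + u * (h v * (v * s v)) - σ * (s v * l v)
      - u * (v * s v * l v) - σ * u * (v * Maxwellian v) - u ^ 2 * (v ^ 2 * Maxwellian v) := by
    intro v
    rw [Lg, hg, ← ss]
    ring
  simp_rw [expand, Lh]
  rw [integral_sub, integral_sub, integral_sub, integral_sub, integral_add]
  · simp only [integral_const_mul]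
    rw [← hu, int_sl, int_vsl, integral_id_mul_Maxwellian, integral_sq_mul_Maxwellian]
    ring
  all_goals fun_prop
end

section
/- (Proposition 3.1(d), hypocoercivity with λ₀ = 1/7) Let h : ℝ → ℝ be a Schwartz function, σ = ∫_ℝ h √M dv, u = ∫_ℝ h v √M dv, and g = (1-Π)h = h - σ√M - u v√M. Then -∫_ℝ h (L h) dv ≥ (1/7) ( ∫_ℝ (1+v²) g(v)² dv + ∫_ℝ g'(v)² dv ) + u². -/
open MeasureTheory Real

open Filter Topology
open scoped SchwartzMap

namespace FokkerPlanck

/-- The ground state `√M` of the Fokker–Planck operator. -/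
noncomputable def groundState (v : ℝ) : ℝ := √(Maxwellian v)

lemma maxwellian_pos (v : ℝ) : 0 < Maxwellian v := by
  unfold Maxwellian; positivity

lemma groundState_pos (v : ℝ) : 0 < groundState v := Real.sqrt_pos.2 (maxwellian_pos v)

lemma maxwellian_eq_sq (v : ℝ) : Maxwellian v = groundState v ^ 2 :=
  (Real.sq_sqrt (maxwellian_pos v).le).symm

lemma maxwellian_rpow (v : ℝ) : Maxwellian v ^ (-(1:ℝ)/2) = (groundState v)⁻¹ := by
  rw [neg_div, Real.rpow_neg (maxwellian_pos v).le, groundState, Real.sqrt_eq_rpow]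

lemma groundState_eq (v : ℝ) :
    groundState v = √((2 * π) ^ (-(1:ℝ)/2)) * exp (-v ^ 2 / 4) := by
  rw [groundState, Maxwellian, Real.sqrt_mul (by positivity), Real.sqrt_eq_rpow (exp _),
    ← Real.exp_mul]
  ring_nf

lemma groundState_hasDerivAt (v : ℝ) :
    HasDerivAt groundState (-(v / 2) * groundState v) v := by
  rw [show groundState = _ from funext groundState_eq]
  have h : HasDerivAt (fun v : ℝ => -v ^ 2 / 4) (-(v / 2)) v := by
    convert! ((hasDerivAt_pow 2 v).neg.div_const 4) using 1
    norm_num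
    ring
  convert! h.exp.const_mul (√((2 * π) ^ (-(1:ℝ)/2))) using 1
  ring

lemma groundState_continuous : Continuous groundState :=
  continuous_iff_continuousAt.2 fun v => (groundState_hasDerivAt v).continuousAt

lemma groundState_le {v w : ℝ} (h : v ^ 2 ≤ w ^ 2) : groundState w ≤ groundState v := by
  rw [groundState_eq, groundState_eq]
  gcongr

lemma integral_groundState_sq : ∫ v, groundState v * groundState v = 1 := by
  rw [← ProbabilityTheory.integral_gaussianPDFReal_eq_one 0 (one_ne_zero (α := NNReal))]
  congr 1 with v
  rw [← sq, ← maxwellian_eq_sq, Maxwellian, ProbabilityTheory.gaussianPDFReal, neg_div,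
    Real.rpow_neg (by positivity), Real.sqrt_eq_rpow]
  simp

/-! ### Polynomials times the ground state are Schwartz functions -/

lemma exists_abs_pow_mul_groundState_le (k : ℕ) : ∃ C, ∀ v, |v| ^ k * groundState v ≤ C := by
  refine ⟨√((2 * π) ^ (-(1:ℝ)/2)) * (1 + 4 ^ k * k.factorial), fun v => ?_⟩
  rw [groundState_eq, neg_div (4 : ℝ) (v ^ 2), Real.exp_neg]
  have h1 := Real.pow_div_factorial_le_exp (x := v ^ 2 / 4) (by positivity) k
  have h2 : 1 ≤ exp (v ^ 2 / 4) := Real.one_le_exp (by positivity)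
  have h3 : |v| ^ k ≤ 1 + (v ^ 2) ^ k := by
    rw [← sq_abs, ← pow_mul, mul_comm, pow_mul]
    nlinarith [sq_nonneg (|v| ^ k - 1)]
  have h4 : (v ^ 2) ^ k ≤ 4 ^ k * k.factorial * exp (v ^ 2 / 4) := by
    rw [div_pow, div_div, div_le_iff₀ (by positivity)] at h1
    linarith
  have h5 : |v| ^ k * (exp (v ^ 2 / 4))⁻¹ ≤ 1 + 4 ^ k * k.factorial := by
    rw [mul_inv_le_iff₀ (exp_pos _)]
    nlinarith
  calc _ = √((2 * π) ^ (-(1:ℝ)/2)) * (|v| ^ k * (exp (v ^ 2 / 4))⁻¹) := by ring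
    _ ≤ _ := by gcongr

lemma exists_abs_pow_mul_eval_mul_groundState_le (p : Polynomial ℝ) :
    ∀ k : ℕ, ∃ C, ∀ v, |v| ^ k * |p.eval v * groundState v| ≤ C := by
  induction p using Polynomial.induction_on' with
  | add p q hp hq =>
    intro k
    obtain ⟨A, hA⟩ := hp k
    obtain ⟨B, hB⟩ := hq k
    refine ⟨A + B, fun v => ?_⟩
    rw [Polynomial.eval_add, add_mul]
    calc _ ≤ |v| ^ k * (|p.eval v * groundState v| + |q.eval v * groundState v|) := by
          gcongr; exact abs_add_le _ _
      _ ≤ A + B := by rw [mul_add]; exact add_le_add (hA v) (hB v)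
  | monomial n a =>
    intro k
    obtain ⟨C, hC⟩ := exists_abs_pow_mul_groundState_le (k + n)
    refine ⟨|a| * C, fun v => ?_⟩
    rw [Polynomial.eval_monomial, abs_mul, abs_mul, abs_pow, abs_of_pos (groundState_pos v)]
    calc _ = |a| * (|v| ^ (k + n) * groundState v) := by ring
      _ ≤ _ := by gcongr; exact hC v

lemma eval_mul_groundState_hasDerivAt (p : Polynomial ℝ) (v : ℝ) :
    HasDerivAt (fun v => p.eval v * groundState v)
      ((p.derivative - Polynomial.C (1 / 2) * Polynomial.X * p).eval v * groundState v) v := by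
  convert! (p.hasDerivAt v).mul (groundState_hasDerivAt v) using 1
  simp
  ring

lemma exists_iteratedDeriv_eval_mul_groundState (p : Polynomial ℝ) (n : ℕ) :
    ∃ q : Polynomial ℝ, iteratedDeriv n (fun v => p.eval v * groundState v) =
      fun v => q.eval v * groundState v := by
  induction n with
  | zero => exact ⟨p, iteratedDeriv_zero⟩
  | succ n ih =>
    obtain ⟨q, hq⟩ := ih
    refine ⟨q.derivative - Polynomial.C (1 / 2) * Polynomial.X * q, ?_⟩
    rw [iteratedDeriv_succ, hq]
    exact funext fun v => (eval_mul_groundState_hasDerivAt q v).deriv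

lemma groundState_contDiff : ContDiff ℝ ⊤ groundState := by
  rw [show groundState = _ from funext groundState_eq]
  fun_prop

/-- The ground state as a Schwartz function. -/
noncomputable def groundStateSchwartz : 𝓢(ℝ, ℝ) where
  toFun := groundState
  smooth' := groundState_contDiff.of_le le_top
  decay' k n := by
    obtain ⟨q, hq⟩ := exists_iteratedDeriv_eval_mul_groundState 1 n
    obtain ⟨C, hC⟩ := exists_abs_pow_mul_eval_mul_groundState_le q k
    refine ⟨C, fun v => ?_⟩
    rw [norm_iteratedFDeriv_eq_norm_iteratedDeriv]
    simp only [Polynomial.eval_one, one_mul] at hq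
    simpa [hq] using hC v

@[simp] lemma groundStateSchwartz_apply (v : ℝ) : groundStateSchwartz v = groundState v := rfl

/-! ### Calculus of Schwartz functions -/

/-- Multiplication by the coordinate on Schwartz functions. -/
noncomputable def coordMul (f : 𝓢(ℝ, ℝ)) : 𝓢(ℝ, ℝ) :=
  SchwartzMap.smulLeftCLM ℝ (fun x : ℝ => x) f

@[simp] lemma coordMul_apply (f : 𝓢(ℝ, ℝ)) (v : ℝ) : coordMul f v = v * f v := by
  exact SchwartzMap.smulLeftCLM_apply_apply (g := fun x : ℝ => x) (by fun_prop) f v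

lemma integrable_mul (f g : 𝓢(ℝ, ℝ)) : Integrable fun v => f v * g v :=
  (SchwartzMap.pairing (ContinuousLinearMap.mul ℝ ℝ) f g).integrable

lemma integral_deriv_mul_add (f g : 𝓢(ℝ, ℝ)) :
    ∫ v, (deriv f v * g v + f v * deriv g v) = 0 :=
  integral_eq_zero_of_hasDerivAt_of_integrable
    (fun v => (f.hasDerivAt v).mul (g.hasDerivAt v))
    ((integrable_mul (SchwartzMap.derivCLM ℝ ℝ f) g).add
      (integrable_mul f (SchwartzMap.derivCLM ℝ ℝ g))) (integrable_mul f g)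

lemma deriv_coordMul (f : 𝓢(ℝ, ℝ)) (v : ℝ) : deriv (coordMul f) v = f v + v * deriv f v := by
  rw [show (coordMul f : ℝ → ℝ) = fun v => v * f v from funext (coordMul_apply f)]
  simpa using ((hasDerivAt_id' v).fun_mul (f.hasDerivAt v)).deriv

lemma deriv_groundStateSchwartz (v : ℝ) :
    deriv groundStateSchwartz v = -(v / 2) * groundState v :=
  (groundState_hasDerivAt v).deriv

/-- The annihilation operator `f ↦ f' + (v / 2) f`. -/
noncomputable def annihilate (f : 𝓢(ℝ, ℝ)) : 𝓢(ℝ, ℝ) :=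
  SchwartzMap.derivCLM ℝ ℝ f + (1 / 2 : ℝ) • coordMul f

@[simp] lemma annihilate_apply (f : 𝓢(ℝ, ℝ)) (v : ℝ) :
    annihilate f v = deriv f v + v / 2 * f v := by
  simp [annihilate]
  ring

lemma annihilate_hasDerivAt (f : 𝓢(ℝ, ℝ)) (v : ℝ) :
    HasDerivAt (annihilate f) (deriv (deriv f) v + (1 / 2 * f v + v / 2 * deriv f v)) v := by
  rw [show (annihilate f : ℝ → ℝ) = _ from funext (annihilate_apply f)]
  exact ((SchwartzMap.derivCLM ℝ ℝ f).hasDerivAt v).add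
    (((hasDerivAt_id v).div_const 2).mul (f.hasDerivAt v))

lemma integral_mul_coord_mul_groundState_sq :
    ∫ v, groundState v * (v * groundState v) = 0 := by
  have h := integral_deriv_mul_add groundStateSchwartz groundStateSchwartz
  simp only [deriv_groundStateSchwartz, groundStateSchwartz_apply] at h
  rw [← neg_eq_zero, ← integral_neg, ← h]
  congr 1 with v
  ring

lemma integral_coord_mul_groundState_sq :
    ∫ v, (v * groundState v) * (v * groundState v) = 1 := by
  have h := integral_deriv_mul_add groundStateSchwartz (coordMul groundStateSchwartz)
  have h1 := integrable_mul groundStateSchwartz groundStateSchwartz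
  have h2 := integrable_mul (coordMul groundStateSchwartz) (coordMul groundStateSchwartz)
  simp only [coordMul_apply, groundStateSchwartz_apply] at h1 h2
  simp only [deriv_groundStateSchwartz, deriv_coordMul, coordMul_apply,
    groundStateSchwartz_apply] at h
  rw [← integral_groundState_sq, eq_comm, ← sub_eq_zero, ← integral_sub h1 h2, ← h]
  congr 1 with v
  ring

lemma integral_annihilate_sq (f : 𝓢(ℝ, ℝ)) :
    ∫ v, annihilate f v ^ 2 =
      (∫ v, deriv f v ^ 2) + (1 / 4) * (∫ v, v ^ 2 * f v ^ 2) - (1 / 2) * ∫ v, f v ^ 2 := by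
  have h := integral_deriv_mul_add f (coordMul f)
  have h1 : Integrable fun v => deriv f v ^ 2 := by
    simpa [sq] using integrable_mul (SchwartzMap.derivCLM ℝ ℝ f) (SchwartzMap.derivCLM ℝ ℝ f)
  have h2 : Integrable fun v => v ^ 2 * f v ^ 2 := by
    simpa [sq, mul_mul_mul_comm] using integrable_mul (coordMul f) (coordMul f)
  have h3 : Integrable fun v => f v ^ 2 := by simpa [sq] using integrable_mul f f
  have h4 : Integrable fun v => deriv f v ^ 2 + 1 / 4 * (v ^ 2 * f v ^ 2) :=
    h1.add (h2.const_mul _)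
  rw [← integral_const_mul, ← integral_const_mul, ← integral_add h1 (h2.const_mul _),
    ← integral_sub h4 (h3.const_mul _), ← sub_eq_zero,
    ← integral_sub, ← mul_zero (1 / 2 : ℝ), ← h, ← integral_const_mul]
  · congr 1 with v
    simp only [annihilate_apply, deriv_coordMul, coordMul_apply]
    ring
  · simpa [sq] using integrable_mul (annihilate f) (annihilate f)
  · exact h4.sub (h3.const_mul _)

lemma FPL_eq (f : 𝓢(ℝ, ℝ)) (v : ℝ) :
    FPL (fun w => f w) v = deriv (deriv f) v + (1 / 2 - v ^ 2 / 4) * f v := by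
  have hquot (w : ℝ) : deriv (fun y => f y * Maxwellian y ^ (-(1:ℝ)/2)) w =
      annihilate f w * (groundState w)⁻¹ := by
    simp only [maxwellian_rpow]
    have hne := (groundState_pos w).ne'
    refine (((f.hasDerivAt w).mul ((groundState_hasDerivAt w).inv hne)).congr_deriv ?_).deriv
    rw [annihilate_apply]
    simp only [Pi.inv_apply]
    field_simp
  have hflux : (fun w => Maxwellian w * deriv (fun y => f y * Maxwellian y ^ (-(1:ℝ)/2)) w) =
      fun w => groundState w * annihilate f w := by
    ext w
    have hne := (groundState_pos w).ne'
    rw [hquot, maxwellian_eq_sq]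
    field_simp
  have hne := (groundState_pos v).ne'
  rw [FPL, hflux, ((groundState_hasDerivAt v).fun_mul (annihilate_hasDerivAt f v)).deriv,
    maxwellian_rpow, annihilate_apply]
  field_simp
  ring

lemma neg_integral_mul_FPL (f : 𝓢(ℝ, ℝ)) :
    -(∫ v, f v * FPL (fun w => f w) v) = ∫ v, annihilate f v ^ 2 := by
  have h := integral_deriv_mul_add f (annihilate f)
  have h1 : Integrable fun v => annihilate f v ^ 2 := by
    simpa [sq] using integrable_mul (annihilate f) (annihilate f)
  have h2 : Integrable fun v => deriv f v * annihilate f v + f v * deriv (annihilate f) v :=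
    (integrable_mul (SchwartzMap.derivCLM ℝ ℝ f) (annihilate f)).add
      (integrable_mul f (SchwartzMap.derivCLM ℝ ℝ (annihilate f)))
  rw [← sub_zero (∫ v, annihilate f v ^ 2), ← h, ← integral_sub h1 h2, ← integral_neg]
  congr 1 with v
  rw [FPL_eq, (annihilate_hasDerivAt f v).deriv, annihilate_apply]
  ring

/-! ### The spectral gap -/

lemma integrable_groundState_mul (f : 𝓢(ℝ, ℝ)) : Integrable fun v => groundState v * f v :=
  integrable_mul groundStateSchwartz f

/-- The solution `f` of `-f' + (v / 2) f = g` that vanishes at `-∞`. -/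
noncomputable def creationInverse (g : 𝓢(ℝ, ℝ)) (v : ℝ) : ℝ :=
  -(∫ w in Set.Iic v, groundState w * g w) / groundState v

lemma creationInverse_hasDerivAt (g : 𝓢(ℝ, ℝ)) (v : ℝ) :
    HasDerivAt (creationInverse g) (v / 2 * creationInverse g v - g v) v := by
  have hintegrable := integrable_groundState_mul g
  have hcont : Continuous fun w => groundState w * g w :=
    groundState_continuous.mul g.continuous
  have hprim : HasDerivAt (fun v => ∫ w in Set.Iic v, groundState w * g w)
      (groundState v * g v) v := by
    have heq : (fun v => ∫ w in Set.Iic v, groundState w * g w) = fun v =>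
        (∫ w in (0 : ℝ)..v, groundState w * g w) + ∫ w in Set.Iic 0, groundState w * g w := by
      ext v
      rw [← intervalIntegral.integral_Iic_sub_Iic hintegrable.integrableOn hintegrable.integrableOn]
      ring
    rw [heq]
    exact (hcont.integral_hasStrictDerivAt 0 v).hasDerivAt.add_const _
  have hne := (groundState_pos v).ne'
  refine (hprim.neg.div (groundState_hasDerivAt v) hne).congr_deriv ?_
  simp only [creationInverse, Pi.neg_apply]
  field_simp
  ring

lemma abs_mul_setIntegral_div_groundState_le (g : 𝓢(ℝ, ℝ)) (v : ℝ) {s : Set ℝ}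
    (hs : MeasurableSet s) (hv : ∀ w ∈ s, |v| ≤ |w|) :
    |v| * |(∫ w in s, groundState w * g w) / groundState v| ≤ ∫ w, |w * g w| := by
  have hintegrable : Integrable fun w => |w * g w| := by
    simpa using (coordMul g).integrable.abs
  have hpos := groundState_pos v
  rw [abs_div, abs_of_pos hpos, ← mul_div_assoc, div_le_iff₀ hpos]
  calc |v| * |∫ w in s, groundState w * g w|
      ≤ |v| * ∫ w in s, |groundState w * g w| := by
        gcongr
        exact abs_integral_le_integral_abs
    _ = ∫ w in s, |v| * |groundState w * g w| := (integral_const_mul _ _).symm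
    _ ≤ ∫ w in s, groundState v * |w * g w| := by
        refine setIntegral_mono_on ((integrable_groundState_mul g).abs.const_mul _).integrableOn
          (hintegrable.const_mul _).integrableOn hs fun w hw => ?_
        rw [abs_mul, abs_mul, abs_of_pos (groundState_pos w)]
        have h1 := groundState_le (sq_le_sq.2 (hv w hw))
        calc |v| * (groundState w * |g w|) ≤ |w| * (groundState v * |g w|) :=
              mul_le_mul (hv w hw) (mul_le_mul_of_nonneg_right h1 (abs_nonneg _))
                (mul_nonneg (groundState_pos w).le (abs_nonneg _)) (abs_nonneg _)
          _ = _ := by ring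
    _ = groundState v * ∫ w in s, |w * g w| := integral_const_mul _ _
    _ ≤ groundState v * ∫ w, |w * g w| := by
        exact mul_le_mul_of_nonneg_left
          (setIntegral_le_integral hintegrable (Eventually.of_forall fun w => abs_nonneg _)) hpos.le
    _ = _ := mul_comm _ _

lemma abs_mul_creationInverse_le (g : 𝓢(ℝ, ℝ)) (hg : ∫ v, groundState v * g v = 0) (v : ℝ) :
    |v| * |creationInverse g v| ≤ ∫ w, |w * g w| := by
  rcases le_total v 0 with hv | hv
  · rw [creationInverse, neg_div, abs_neg]
    refine abs_mul_setIntegral_div_groundState_le g v measurableSet_Iic fun w hw => ?_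
    rw [Set.mem_Iic] at hw
    rw [abs_of_nonpos hv, abs_of_nonpos (hw.trans hv)]
    linarith
  · have hintegrable := integrable_groundState_mul g
    have h : -(∫ w in Set.Iic v, groundState w * g w) =
        ∫ w in Set.Ioi v, groundState w * g w := by
      rw [neg_eq_iff_add_eq_zero, intervalIntegral.integral_Iic_add_Ioi hintegrable.integrableOn
        hintegrable.integrableOn, hg]
    rw [creationInverse, h]
    refine abs_mul_setIntegral_div_groundState_le g v measurableSet_Ioi fun w hw => ?_
    rw [Set.mem_Ioi] at hw
    rw [abs_of_nonneg hv, abs_of_nonneg (hv.trans hw.le)]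
    exact hw.le

lemma creationInverse_boundary_tendsto (g : 𝓢(ℝ, ℝ)) (hg : ∫ v, groundState v * g v = 0) :
    Tendsto (fun v => 2 * g v * creationInverse g v - v * creationInverse g v ^ 2)
      (cocompact ℝ) (𝓝 0) := by
  set K := ∫ w, |w * g w|
  have hbound := abs_mul_creationInverse_le g hg
  have hf : Tendsto (creationInverse g) (cocompact ℝ) (𝓝 0) := by
    have habs : Tendsto (fun v : ℝ => |v|) (cocompact ℝ) atTop :=
      tendsto_norm_cocompact_atTop
    refine squeeze_zero_norm' ?_ (habs.const_div_atTop K)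
    filter_upwards [habs.eventually_gt_atTop 0] with v hv
    rw [Real.norm_eq_abs, le_div_iff₀ hv, mul_comm]
    exact hbound v
  have h1 : Tendsto (fun v => 2 * g v * creationInverse g v) (cocompact ℝ) (𝓝 0) := by
    simpa using (g.tendsto_cocompact.const_mul 2).mul hf
  have h2 : Tendsto (fun v => v * creationInverse g v ^ 2) (cocompact ℝ) (𝓝 0) := by
    refine squeeze_zero_norm (fun v => ?_) (by simpa using hf.abs.const_mul K)
    rw [norm_mul, norm_pow, Real.norm_eq_abs, Real.norm_eq_abs, sq, ← mul_assoc]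
    gcongr
    exact hbound v
  simpa using h1.sub h2

/-- Poincaré's inequality for the Gaussian measure, in ground state form. -/
lemma integral_sq_le_integral_annihilate_sq (g : 𝓢(ℝ, ℝ))
    (hg : ∫ v, groundState v * g v = 0) :
    ∫ v, g v ^ 2 ≤ ∫ v, annihilate g v ^ 2 := by
  set f := creationInverse g with hf
  have hderiv := creationInverse_hasDerivAt g
  have hfc : Continuous f := continuous_iff_continuousAt.2 fun v => (hderiv v).continuousAt
  have hg' : Continuous (deriv g) := (SchwartzMap.derivCLM ℝ ℝ g).continuous
  have h1 : Integrable fun v => annihilate g v ^ 2 := by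
    simpa [sq] using integrable_mul (annihilate g) (annihilate g)
  have h2 : Integrable fun v => g v ^ 2 := by simpa [sq] using integrable_mul g g
  set W' : ℝ → ℝ := fun v => 2 * deriv g v * f v + 2 * g v * (v / 2 * f v - g v) -
    (f v ^ 2 + v * (2 * f v * (v / 2 * f v - g v))) with hW'
  have hW (v : ℝ) : HasDerivAt (fun v => 2 * g v * f v - v * f v ^ 2) (W' v) v := by
    refine ((((g.hasDerivAt v).const_mul 2).fun_mul (hderiv v)).fun_sub
      ((hasDerivAt_id' v).fun_mul ((hderiv v).fun_pow 2))).congr_deriv ?_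
    simp [hW', hf]
  have hW'c : Continuous W' := by
    have := g.continuous
    fun_prop
  have hle (v : ℝ) : W' v ≤ annihilate g v ^ 2 - g v ^ 2 := by
    rw [annihilate_apply, hW']
    nlinarith [sq_nonneg (deriv g v + v / 2 * g v - f v), sq_nonneg (g v - v * f v)]
  have hlim := creationInverse_boundary_tendsto g hg
  have hleft := ((hlim.mono_left atTop_le_cocompact).sub
    ((hlim.mono_left atBot_le_cocompact).comp tendsto_neg_atTop_atBot))
  have hright := intervalIntegral_tendsto_integral (h1.sub h2) tendsto_neg_atTop_atBot tendsto_id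
  rw [← sub_nonneg, ← integral_sub h1 h2, ← sub_zero (0 : ℝ)]
  refine le_of_tendsto_of_tendsto hleft hright ?_
  filter_upwards [eventually_ge_atTop 0] with R hR
  have hFTC := intervalIntegral.integral_eq_sub_of_hasDerivAt (a := -R) (b := R)
    (fun v _ => hW v) (hW'c.intervalIntegrable _ _)
  simp only [Function.comp_apply, id]
  rw [← hFTC]
  exact intervalIntegral.integral_mono_on (by linarith) (hW'c.intervalIntegrable _ _)
    (h1.sub h2).intervalIntegrable fun v _ => hle v

/-! ### Coercivity -/

lemma integral_groundState_mul_annihilate (g : 𝓢(ℝ, ℝ)) :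
    ∫ v, groundState v * annihilate g v = ∫ v, v * groundState v * g v := by
  have h := integral_deriv_mul_add groundStateSchwartz g
  have h1 : Integrable fun v => v * groundState v * g v := by
    simpa using integrable_mul (coordMul groundStateSchwartz) g
  rw [← sub_eq_zero, ← integral_sub (integrable_groundState_mul _) h1, ← h]
  congr 1 with v
  rw [annihilate_apply, deriv_groundStateSchwartz, groundStateSchwartz_apply]
  ring

lemma weightedNorm_le_integral_annihilate_sq (g : 𝓢(ℝ, ℝ))
    (hg : ∫ v, groundState v * g v = 0) :
    1 / 7 * ((∫ v, (1 + v ^ 2) * g v ^ 2) + ∫ v, deriv g v ^ 2) ≤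
      ∫ v, annihilate g v ^ 2 := by
  have h1 : Integrable fun v => g v ^ 2 := by simpa [sq] using integrable_mul g g
  have h2 : Integrable fun v => v ^ 2 * g v ^ 2 := by
    simpa [sq, mul_mul_mul_comm] using integrable_mul (coordMul g) (coordMul g)
  have hsplit : ∫ v, (1 + v ^ 2) * g v ^ 2 = (∫ v, g v ^ 2) + ∫ v, v ^ 2 * g v ^ 2 := by
    rw [← integral_add h1 h2]
    congr 1 with v
    ring
  have hgap := integral_sq_le_integral_annihilate_sq g hg
  have hpos : 0 ≤ ∫ v, deriv g v ^ 2 := integral_nonneg fun v => sq_nonneg _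
  rw [hsplit]
  linarith [integral_annihilate_sq g]

/-- The microscopic part `(1 - Π) h` when `a` and `b` are the macroscopic moments of `h`. -/
noncomputable def microscopic (h : 𝓢(ℝ, ℝ)) (a b : ℝ) : 𝓢(ℝ, ℝ) :=
  h - a • groundStateSchwartz - b • coordMul groundStateSchwartz

lemma microscopic_apply (h : 𝓢(ℝ, ℝ)) (a b v : ℝ) :
    microscopic h a b v = h v - a * groundState v - b * (v * groundState v) := by
  simp [microscopic]

lemma integral_mul_microscopic (h f : 𝓢(ℝ, ℝ)) (a b : ℝ) :
    ∫ v, f v * microscopic h a b v = (∫ v, h v * f v) - a * (∫ v, f v * groundState v) -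
      b * ∫ v, f v * (v * groundState v) := by
  have h1 := integrable_mul h f
  have h2 : Integrable fun v => a * (f v * groundState v) :=
    (integrable_mul f groundStateSchwartz).const_mul a
  have h3 : Integrable fun v => b * (f v * (v * groundState v)) := by
    simpa using (integrable_mul f (coordMul groundStateSchwartz)).const_mul b
  rw [← integral_const_mul, ← integral_const_mul, ← integral_sub h1 h2,
    ← integral_sub (by exact h1.sub h2) h3]
  congr 1 with v
  rw [microscopic_apply]
  ring

lemma annihilate_eq_add_microscopic (h : 𝓢(ℝ, ℝ)) (a b v : ℝ) :
    annihilate h v = annihilate (microscopic h a b) v + b * groundState v := by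
  have hd : deriv (microscopic h a b) v = deriv h v - a * (-(v / 2) * groundState v) -
      b * (groundState v + v * (-(v / 2) * groundState v)) := by
    rw [show (microscopic h a b : ℝ → ℝ) = _ from funext (microscopic_apply h a b)]
    refine ((((h.hasDerivAt v).fun_sub ((groundState_hasDerivAt v).const_mul a)).fun_sub
      (((hasDerivAt_id' v).fun_mul (groundState_hasDerivAt v)).const_mul b)).congr_deriv ?_).deriv
    ring
  rw [annihilate_apply, annihilate_apply, hd, microscopic_apply]
  ring

lemma integral_annihilate_sq_eq_add (h : 𝓢(ℝ, ℝ)) (a b : ℝ)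
    (horth : ∫ v, v * groundState v * microscopic h a b v = 0) :
    ∫ v, annihilate h v ^ 2 = (∫ v, annihilate (microscopic h a b) v ^ 2) + b ^ 2 := by
  set g := microscopic h a b
  have h1 : Integrable fun v => annihilate g v ^ 2 := by
    simpa [sq] using integrable_mul (annihilate g) (annihilate g)
  have h2 : Integrable fun v => 2 * b * (groundState v * annihilate g v) :=
    (integrable_groundState_mul (annihilate g)).const_mul _
  have h3 : Integrable fun v => b ^ 2 * (groundState v * groundState v) :=
    (integrable_groundState_mul groundStateSchwartz).const_mul _
  calc ∫ v, annihilate h v ^ 2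
      = ∫ v, (annihilate g v ^ 2 + 2 * b * (groundState v * annihilate g v) +
          b ^ 2 * (groundState v * groundState v)) := by
        congr 1 with v
        rw [annihilate_eq_add_microscopic h a b]
        ring
    _ = _ := by
        rw [integral_add (by exact h1.add h2) h3, integral_add h1 h2, integral_const_mul,
          integral_const_mul, integral_groundState_mul_annihilate, horth,
          integral_groundState_sq]
        ring

end FokkerPlanck

open FokkerPlanck

theorem prop_3_1_d_hypocoercivity (h : SchwartzMap ℝ ℝ) (σ u : ℝ)
    (hσ : σ = ∫ v : ℝ, h v * Real.sqrt (Maxwellian v))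
    (hu : u = ∫ v : ℝ, h v * (v * Real.sqrt (Maxwellian v)))
    (g : ℝ → ℝ)
    (hg : g = fun v => h v - σ * Real.sqrt (Maxwellian v) - u * (v * Real.sqrt (Maxwellian v))) :
    -(∫ v : ℝ, h v * FPL (fun w => h w) v)
      ≥ (1/7) * ((∫ v : ℝ, (1 + v^2) * (g v)^2) + ∫ v : ℝ, (deriv g v)^2) + u^2 := by
  have hg' : g = microscopic h σ u := by
    rw [hg]
    ext v
    rw [microscopic_apply]
    rfl
  have horth0 : ∫ v, groundState v * microscopic h σ u v = 0 := by
    have := integral_mul_microscopic h groundStateSchwartz σ u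
    simp only [groundStateSchwartz_apply, integral_groundState_sq,
      integral_mul_coord_mul_groundState_sq] at this
    rw [this, hσ]
    simp [groundState]
  have horth1 : ∫ v, v * groundState v * microscopic h σ u v = 0 := by
    have := integral_mul_microscopic h (coordMul groundStateSchwartz) σ u
    simp only [coordMul_apply, groundStateSchwartz_apply, integral_coord_mul_groundState_sq,
      mul_comm (_ * groundState _) (groundState _),
      integral_mul_coord_mul_groundState_sq] at this
    simp only [mul_comm (_ * groundState _)] at this ⊢
    rw [this, hu]
    simp [groundState]
  rw [neg_integral_mul_FPL, integral_annihilate_sq_eq_add h σ u horth1, hg', ge_iff_le]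
  gcongr
  exact weightedNorm_le_integral_annihilate_sq _ horth0
end

section
/- (Abstract Lyapunov bootstrap) Let α > 0 and β > 0. Let Ê : [0,∞) → ℝ be differentiable and D : [0,∞) → ℝ be such that for all t ≥ 0: Ê(t) ≥ 0, D(t) ≥ Ê(t), and (1/2) Ê'(t) + α D(t) ≤ β √(Ê(t)) D(t). If Ê(0) ≤ (α/(2β))², then √(Ê(t)) ≤ α/(2β) for all t ≥ 0, the differential inequality (1/2) Ê'(t) + (α/2) D(t) ≤ 0 holds for all t ≥ 0, and consequently Ê(t) ≤ Ê(0) e^{-α t} for all t ≥ 0. -/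
/-- Grönwall-type decay: `E' ≤ -α E` on `[0, ∞)` gives `E t ≤ E 0 * exp (-α t)`. -/
theorem le_mul_exp_neg_of_deriv_le {α : ℝ} {E : ℝ → ℝ}
    (hdiff : ∀ t ≥ (0:ℝ), DifferentiableAt ℝ E t)
    (hderiv : ∀ t ≥ (0:ℝ), deriv E t ≤ -α * E t) {t : ℝ} (ht : 0 ≤ t) :
    E t ≤ E 0 * Real.exp (-α * t) := by
  have hd : ∀ s ≥ (0:ℝ), HasDerivAt (fun s => E s * Real.exp (α * s))
      (deriv E s * Real.exp (α * s) + E s * (Real.exp (α * s) * (α * 1))) s := fun s hs =>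
    (hdiff s hs).hasDerivAt.mul ((hasDerivAt_id s).const_mul α).exp
  have hanti : AntitoneOn (fun s => E s * Real.exp (α * s)) (Set.Ici 0) := by
    refine antitoneOn_of_hasDerivWithinAt_nonpos (convex_Ici 0)
      (fun s hs => (hd s hs).continuousAt.continuousWithinAt)
      (fun s hs => (hd s (interior_subset hs)).hasDerivWithinAt) fun s hs => ?_
    nlinarith [hderiv s (interior_subset hs), Real.exp_pos (α * s)]
  have h : E t * Real.exp (α * t) ≤ E 0 := by
    simpa using hanti Set.self_mem_Ici ht ht
  rwa [neg_mul, Real.exp_neg, ← div_eq_mul_inv, le_div_iff₀ (Real.exp_pos _)]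

/-- A function whose derivative is negative whenever it equals `c` cannot cross `c` upwards. -/
theorem le_const_of_deriv_neg_of_eq {E : ℝ → ℝ} {c : ℝ}
    (hdiff : ∀ t ≥ (0:ℝ), DifferentiableAt ℝ E t) (hinit : E 0 ≤ c)
    (hneg : ∀ t ≥ (0:ℝ), E t = c → deriv E t < 0) {t : ℝ} (ht : 0 ≤ t) : E t ≤ c :=
  image_le_of_deriv_right_lt_deriv_boundary' (B := fun _ => c) (B' := fun _ => 0)
    (fun s hs => (hdiff s hs.1).continuousAt.continuousWithinAt)
    (fun s hs => (hdiff s hs.1).hasDerivAt.hasDerivWithinAt) hinit continuousOn_const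
    (fun _ _ => hasDerivWithinAt_const _ _ _) (fun s hs => hneg s hs.1)
    (Set.right_mem_Icc.2 ht)

theorem abstract_lyapunov_bootstrap (α β : ℝ) (hα : α > 0) (hβ : β > 0)
    (E D : ℝ → ℝ)
    (hdiff : ∀ t ≥ (0:ℝ), DifferentiableAt ℝ E t)
    (hnonneg : ∀ t ≥ (0:ℝ), E t ≥ 0)
    (hDE : ∀ t ≥ (0:ℝ), D t ≥ E t)
    (hineq : ∀ t ≥ (0:ℝ), (1/2) * deriv E t + α * D t ≤ β * Real.sqrt (E t) * D t)
    (hinit : E 0 ≤ (α / (2 * β))^2) :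
    (∀ t ≥ (0:ℝ), Real.sqrt (E t) ≤ α / (2 * β)) ∧
    (∀ t ≥ (0:ℝ), (1/2) * deriv E t + (α/2) * D t ≤ 0) ∧
    (∀ t ≥ (0:ℝ), E t ≤ E 0 * Real.exp (-α * t)) := by
  have hc : 0 < α / (2 * β) := by positivity
  have hβc : β * (α / (2 * β)) = α / 2 := by field_simp
  have hdiss : ∀ t ≥ (0:ℝ), Real.sqrt (E t) ≤ α / (2 * β) →
      (1/2) * deriv E t + (α/2) * D t ≤ 0 := fun t ht hsqrt => by
    have hD : 0 ≤ D t := (hnonneg t ht).trans (hDE t ht)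
    have hle : β * Real.sqrt (E t) * D t ≤ α / 2 * D t := by
      rw [← hβc]
      gcongr
    linarith [hineq t ht]
  have hsqrt : ∀ t ≥ (0:ℝ), Real.sqrt (E t) ≤ α / (2 * β) := fun t ht => by
    refine Real.sqrt_le_iff.2 ⟨hc.le, le_const_of_deriv_neg_of_eq hdiff hinit ?_ ht⟩
    intro s hs hEs
    have hD : 0 < D s := (hEs ▸ pow_pos hc 2 : 0 < E s).trans_le (hDE s hs)
    linarith [hdiss s hs (Real.sqrt_le_iff.2 ⟨hc.le, hEs.le⟩), mul_pos hα hD]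
  refine ⟨hsqrt, fun t ht => hdiss t ht (hsqrt t ht), fun t ht =>
    le_mul_exp_neg_of_deriv_le hdiff (fun s hs => ?_) ht⟩
  linarith [hdiss s hs (hsqrt s hs), mul_le_mul_of_nonneg_left (hDE s hs) hα.le]
end

section
/- (High-field norm equivalence) Let 0 < ε ≤ 1, let λ₀ ∈ (0, 1/4], and let E_h ≥ 0, E_φ ≥ 0, and G be real numbers satisfying -ε² E_h + (1/4) E_φ ≤ G ≤ ε² E_h + (3/4) E_φ. Define Ê = ε E_h + E_φ + (2λ₀/ε) G and E = ε E_h + (1/ε) E_φ. Then (λ₀/2) E ≤ Ê ≤ (3/2) E. -/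
theorem high_field_norm_equivalence (ε lam0 E_h E_φ G : ℝ)
    (hε : 0 < ε) (hε1 : ε ≤ 1) (hlam0 : 0 < lam0) (hlam1 : lam0 ≤ 1/4)
    (hEh : E_h ≥ 0) (hEφ : E_φ ≥ 0)
    (hGl : -ε^2 * E_h + (1/4) * E_φ ≤ G)
    (hGu : G ≤ ε^2 * E_h + (3/4) * E_φ) :
    (lam0/2) * (ε * E_h + (1/ε) * E_φ)
        ≤ ε * E_h + E_φ + (2*lam0/ε) * G ∧
      ε * E_h + E_φ + (2*lam0/ε) * G
        ≤ (3/2) * (ε * E_h + (1/ε) * E_φ) := by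
  have hx : 0 ≤ ε * E_h := mul_nonneg hε.le hEh
  have hF : E_φ ≤ 1 / ε * E_φ :=
    le_mul_of_one_le_left hEφ ((one_le_div hε).2 hε1)
  have hc : 0 ≤ 2 * lam0 / ε := by positivity
  have hl : -(2 * lam0) * (ε * E_h) + lam0 / 2 * (1 / ε * E_φ) ≤ 2 * lam0 / ε * G := by
    refine le_of_eq_of_le ?_ (mul_le_mul_of_nonneg_left hGl hc)
    field_simp
    ring
  have hu : 2 * lam0 / ε * G ≤ 2 * lam0 * (ε * E_h) + 3 * lam0 / 2 * (1 / ε * E_φ) := by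
    refine (mul_le_mul_of_nonneg_left hGu hc).trans_eq ?_
    field_simp
    ring
  have hlx : lam0 * (ε * E_h) ≤ 1 / 4 * (ε * E_h) := mul_le_mul_of_nonneg_right hlam1 hx
  have hlF : lam0 * (1 / ε * E_φ) ≤ 1 / 4 * (1 / ε * E_φ) :=
    mul_le_mul_of_nonneg_right hlam1 (hEφ.trans hF)
  constructor <;> linarith
end
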